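/- arXiv:2309.13366 — 5 statements merged into one kernel-verified Lean document; each statement's English description precedes it below -/
import Mathlib

section
/- Let A be a relation algebra. Then the reduct (A, ·, 0, 1, ;, ˘, 1') obtained by deleting + and complementation is a J-algebra, i.e., it satisfies all thirteen J-algebra axioms. -/
/-- A relation algebra in Tarski's axiomatization, with ·, 1 and 0 given by
their defining equations. -/
structure RAlgebra (A : Type*) where
  add : A → A → A          -- +
  compl : A → A            -- complement ⁻
  meet : A → A → A         -- ·
  zero : A                 -- 0
  one : A                  -- 1
  comp : A → A → A         -- ;
  conv : A → A             -- ˘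
  ident : A                -- 1'
  ra1 : ∀ x y, add x y = add y x
  ra2 : ∀ x y z, add x (add y z) = add (add x y) z
  ra3 : ∀ x y, add (compl (add (compl x) (compl y))) (compl (add (compl x) y)) = x
  ra4 : ∀ x y z, comp x (comp y z) = comp (comp x y) z
  ra5 : ∀ x y z, comp (add x y) z = add (comp x z) (comp y z)
  ra6 : ∀ x, comp x ident = x
  ra7 : ∀ x, conv (conv x) = x
  ra8 : ∀ x y, conv (add x y) = add (conv x) (conv y)
  ra9 : ∀ x y, conv (comp x y) = comp (conv y) (conv x)
  ra10 : ∀ x y, add (comp (conv x) (compl (comp x y))) (compl y) = compl y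
  ra11 : ∀ x y, meet x y = compl (add (compl x) (compl y))
  ra12 : one = add ident (compl ident)
  ra13 : zero = compl one

namespace RAlgebra

variable {A : Type*} (R : RAlgebra A)

/-! ### Huntington's axioms give a Boolean algebra -/

lemma add_compl_eq_add_compl (x y : A) : R.add x (R.compl x) = R.add y (R.compl y) := by
  have hx := R.ra3 x (R.compl y)
  have hx' := R.ra3 (R.compl x) (R.compl y)
  have hy := R.ra3 y (R.compl x)
  have hy' := R.ra3 (R.compl y) (R.compl x)
  have := R.ra1
  have := R.ra2
  grind

lemma compl_compl (x : A) : R.compl (R.compl x) = x := by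
  have h₁ := R.ra3 (R.compl (R.compl x)) (R.compl x)
  have h₂ := R.ra3 x (R.compl (R.compl x))
  have h₃ := R.add_compl_eq_add_compl (R.compl x) (R.compl (R.compl x))
  have := R.ra1
  grind

lemma add_compl (x : A) : R.add x (R.compl x) = R.one := by
  rw [R.ra12, R.add_compl_eq_add_compl]

lemma compl_one : R.compl R.one = R.zero := R.ra13.symm

lemma compl_zero : R.compl R.zero = R.one := by rw [R.ra13, compl_compl]

lemma compl_add_compl_self_add_zero (x : A) :
    R.add (R.compl (R.add (R.compl x) (R.compl x))) R.zero = x := by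
  have h := R.ra3 x x
  rwa [R.ra1 (R.compl x) x, add_compl, compl_one] at h

lemma one_add_one : R.add R.one R.one = R.one := by
  have h₀ := R.compl_add_compl_self_add_zero R.zero
  rw [compl_zero] at h₀
  have h₁ : R.add R.one R.zero = R.one := by rw [← compl_one, add_compl]
  have h₂ : R.add R.one (R.compl (R.add R.one R.one)) = R.one := by
    conv_rhs => rw [← h₁, ← h₀, R.ra1 _ R.zero, R.ra2, h₁]
  conv_lhs => rw [← h₂, R.ra2, h₂]
  conv_lhs => rw [← h₂]
  rw [R.ra1 _ R.one, R.ra2, add_compl]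

lemma zero_add_zero : R.add R.zero R.zero = R.zero := by
  have h := R.compl_add_compl_self_add_zero R.zero
  rwa [compl_zero, one_add_one, compl_one] at h

lemma add_zero (x : A) : R.add x R.zero = x := by
  conv_lhs => rw [← R.compl_add_compl_self_add_zero x, ← R.ra2, zero_add_zero]
  exact R.compl_add_compl_self_add_zero x

lemma add_self (x : A) : R.add x x = x := by
  have h := R.compl_add_compl_self_add_zero (R.compl x)
  rw [add_zero, compl_compl] at h
  rw [← R.compl_compl (R.add x x), h, compl_compl]

lemma meet_add_meet_compl (x y : A) : R.add (R.meet x y) (R.meet x (R.compl y)) = x := by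
  rw [R.ra11, R.ra11, compl_compl, R.ra3]

lemma meet_add_self (x y : A) : R.add (R.meet x y) x = x := by
  calc R.add (R.meet x y) x
      = R.add (R.meet x y) (R.add (R.meet x y) (R.meet x (R.compl y))) := by
        rw [meet_add_meet_compl]
    _ = x := by rw [R.ra2, add_self, meet_add_meet_compl]

lemma meet_comm (x y : A) : R.meet x y = R.meet y x := by
  rw [R.ra11, R.ra11, R.ra1]

lemma meet_assoc (x y z : A) : R.meet x (R.meet y z) = R.meet (R.meet x y) z := by
  simp only [R.ra11, compl_compl, R.ra2]

lemma compl_add (x y : A) : R.compl (R.add x y) = R.meet (R.compl x) (R.compl y) := by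
  rw [R.ra11, compl_compl, compl_compl]

lemma meet_compl (x : A) : R.meet x (R.compl x) = R.zero := by
  rw [R.ra11, compl_compl, R.ra1, add_compl, compl_one]

lemma meet_zero (x : A) : R.meet x R.zero = R.zero := by
  rw [← R.meet_compl x, meet_assoc, R.ra11 x x, add_self, compl_compl]

lemma add_eq_right_iff_meet_compl (x y : A) :
    R.add x y = y ↔ R.meet x (R.compl y) = R.zero := by
  constructor
  · intro h
    rw [← h, compl_add, meet_assoc, meet_compl, meet_comm, meet_zero]
  · intro h
    have hx := R.meet_add_meet_compl x y
    rw [h, add_zero, meet_comm] at hx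
    rw [← hx, meet_add_self]

lemma meet_add_eq_right_iff (x y z : A) :
    R.add (R.meet x y) z = z ↔ R.add x (R.add (R.compl y) z) = R.add (R.compl y) z := by
  rw [add_eq_right_iff_meet_compl, add_eq_right_iff_meet_compl, compl_add, compl_compl,
    meet_assoc]

/-- The lattice underlying a relation algebra. -/
abbrev toLattice : Lattice A where
  le x y := R.add x y = y
  le_refl := R.add_self
  le_trans x y z hxy hyz := by
    rw [← hyz, R.ra2, hxy]
  le_antisymm x y hxy hyx := by rw [← hxy, R.ra1, hyx]
  sup := R.add
  le_sup_left x y := by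
    rw [R.ra2, add_self]
  le_sup_right x y := by
    rw [R.ra1 x y, R.ra2, add_self]
  sup_le x y z hx hy := by
    rw [← R.ra2, hy, hx]
  inf := R.meet
  inf_le_left := R.meet_add_self
  inf_le_right x y := by
    rw [meet_comm]
    exact R.meet_add_self y x
  le_inf x y z hy hz := by
    rw [add_eq_right_iff_meet_compl] at hy hz
    have hx : R.meet x y = x := by
      have h := R.meet_add_meet_compl x y
      rwa [hy, add_zero] at h
    have hx' : R.meet x z = x := by
      have h := R.meet_add_meet_compl x z
      rwa [hz, add_zero] at h
    have h : R.meet (R.meet y z) x = x := by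
      rw [meet_comm, meet_assoc, hx, hx']
    rw [← h, R.ra1, R.ra1, meet_add_self]

/-- The Boolean algebra underlying a relation algebra. -/
abbrev toBooleanAlgebra : BooleanAlgebra A where
  __ := R.toLattice
  le_sup_inf x y z := by
    let _ := R.toLattice
    have residuation (a b c : A) : a ⊓ b ≤ c ↔ a ≤ R.compl b ⊔ c := R.meet_add_eq_right_iff a b c
    have distrib (a b c : A) : (a ⊔ b) ⊓ c ≤ (a ⊓ c) ⊔ (b ⊓ c) := by
      rw [residuation]
      exact sup_le ((residuation _ _ _).1 le_sup_left) ((residuation _ _ _).1 le_sup_right)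
    change (x ⊔ y) ⊓ (x ⊔ z) ≤ x ⊔ y ⊓ z
    refine (distrib _ _ _).trans (sup_le (inf_le_left.trans le_sup_left) ?_)
    rw [inf_comm]
    refine (distrib _ _ _).trans (sup_le (inf_le_left.trans le_sup_left) ?_)
    rw [inf_comm]
    exact le_sup_right
  compl := R.compl
  top := R.one
  bot := R.zero
  le_top x := by
    change R.add x R.one = R.one
    rw [← R.add_compl x, R.ra2, add_self]
  bot_le x := by
    change R.add R.zero x = x
    rw [R.ra1, add_zero]
  inf_compl_le_bot x := by
    change R.add (R.meet x (R.compl x)) R.zero = R.zero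
    rw [meet_compl, add_self]
  top_le_sup_compl x := by
    change R.add R.one (R.add x (R.compl x)) = R.add x (R.compl x)
    rw [add_compl, add_self]

/-! ### Converse and composition -/

lemma comp_add (x y z : A) : R.comp x (R.add y z) = R.add (R.comp x y) (R.comp x z) := by
  rw [← R.ra7 (R.comp x (R.add y z)), R.ra9, R.ra8, R.ra5, R.ra8, R.ra9, R.ra9]
  simp only [R.ra7]

lemma le_iff (x y : A) : letI := R.toBooleanAlgebra; x ≤ y ↔ R.add x y = y := Iff.rfl

lemma conv_le_conv_iff (x y : A) :
    letI := R.toBooleanAlgebra; R.conv x ≤ R.conv y ↔ x ≤ y := by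
  rw [le_iff, le_iff, ← R.ra8]
  exact (Function.LeftInverse.injective R.ra7).eq_iff

/-- Converse as an automorphism of the underlying Boolean algebra. -/
def convOrderIso : letI := R.toBooleanAlgebra; A ≃o A :=
  letI := R.toBooleanAlgebra
  { toFun := R.conv
    invFun := R.conv
    left_inv := R.ra7
    right_inv := R.ra7
    map_rel_iff' := R.conv_le_conv_iff _ _ }

lemma conv_meet (x y : A) : R.conv (R.meet x y) = R.meet (R.conv x) (R.conv y) :=
  let _ := R.toBooleanAlgebra
  map_inf R.convOrderIso x y

lemma disjoint_conv_iff (x y : A) :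
    letI := R.toBooleanAlgebra; Disjoint (R.conv x) (R.conv y) ↔ Disjoint x y :=
  let _ := R.toBooleanAlgebra
  disjoint_map_orderIso_iff R.convOrderIso

lemma comp_le_comp {x x' y y' : A} :
    letI := R.toBooleanAlgebra; x ≤ x' → y ≤ y' → R.comp x y ≤ R.comp x' y' := by
  let _ := R.toBooleanAlgebra
  intro hx hy
  have h₁ : R.comp x y ≤ R.comp x' y := by
    rw [le_iff] at hx ⊢
    rw [← R.ra5, hx]
  refine h₁.trans ?_
  rw [le_iff] at hy ⊢
  rw [← comp_add, hy]

lemma disjoint_conv_comp {x y z : A} :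
    letI := R.toBooleanAlgebra; Disjoint (R.comp x y) z → Disjoint (R.comp (R.conv x) z) y := by
  let _ := R.toBooleanAlgebra
  intro h
  have h' : R.comp (R.conv x) (R.comp x y)ᶜ ≤ yᶜ := R.ra10 x y
  exact le_compl_iff_disjoint_right.1 ((R.comp_le_comp le_rfl h.le_compl_left).trans h')

lemma disjoint_comp_conv {x y z : A} :
    letI := R.toBooleanAlgebra; Disjoint (R.comp x y) z → Disjoint (R.comp z (R.conv y)) x := by
  let _ := R.toBooleanAlgebra
  intro h
  rw [← disjoint_conv_iff, R.ra9] at h ⊢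
  exact R.disjoint_conv_comp h

lemma comp_inf_le (x y z : A) :
    letI := R.toBooleanAlgebra
    R.comp x y ⊓ z ≤ R.comp (R.comp z (R.conv y) ⊓ x) (y ⊓ R.comp (R.conv x) z) := by
  let _ := R.toBooleanAlgebra
  set p := R.comp z (R.conv y)
  set q := R.comp (R.conv x) z
  have hx : x = R.add (p ⊓ x) (x \ p) := by
    rw [inf_comm]
    exact (sup_inf_sdiff x p).symm
  have hy : y = R.add (y ⊓ q) (y \ q) := (sup_inf_sdiff y q).symm
  have h₁ : Disjoint (R.comp (x \ p) y) z := by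
    have h := R.disjoint_comp_conv (disjoint_sdiff_self_right : Disjoint p (x \ p))
    rwa [R.ra7] at h
  have h₂ : Disjoint (R.comp (p ⊓ x) (y \ q)) z := by
    have h := R.disjoint_conv_comp (disjoint_sdiff_self_right : Disjoint q (y \ q))
    rw [R.ra7] at h
    exact h.mono_left (R.comp_le_comp inf_le_right le_rfl)
  have h₃ : R.comp x y =
      (R.comp (p ⊓ x) (y ⊓ q) ⊔ R.comp (p ⊓ x) (y \ q)) ⊔ R.comp (x \ p) y := by
    calc R.comp x y = R.comp (p ⊓ x) y ⊔ R.comp (x \ p) y := by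
          conv_lhs => rw [hx]
          exact R.ra5 _ _ _
      _ = _ := by
          congr 1
          conv_lhs => rw [hy]
          exact R.comp_add _ _ _
  rw [h₃, inf_sup_right, inf_sup_right, h₁.eq_bot, h₂.eq_bot, sup_bot_eq, sup_bot_eq]
  exact inf_le_left

lemma comp_zero (x : A) : R.comp x R.zero = R.zero := by
  let _ := R.toBooleanAlgebra
  have h := R.disjoint_conv_comp (disjoint_bot_right : Disjoint (R.comp (R.conv x) ⊤) ⊥)
  rw [R.ra7] at h
  exact disjoint_top.1 h

end RAlgebra

/-- The reduct (A, ·, 0, 1, ;, ˘, 1') of a relation algebra, obtained by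
deleting + and complementation, satisfies all thirteen J-algebra axioms. -/
theorem ra_reduct_is_JAlgebra {A : Type*} (R : RAlgebra A) :
    (∀ x y z, R.meet x (R.meet y z) = R.meet (R.meet x y) z) ∧
    (∀ x y, R.meet x y = R.meet y x) ∧
    (∀ x, R.meet x x = x) ∧
    (∀ x y z, R.comp x (R.comp y z) = R.comp (R.comp x y) z) ∧
    (∀ x, R.comp x R.ident = x) ∧
    (∀ x y z, R.comp (R.meet x y) z = R.meet (R.comp (R.meet x y) z) (R.comp y z)) ∧
    (∀ x, R.conv (R.conv x) = x) ∧
    (∀ x y, R.conv (R.comp x y) = R.comp (R.conv y) (R.conv x)) ∧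
    (∀ x y, R.conv (R.meet x y) = R.meet (R.conv x) (R.conv y)) ∧
    (∀ x y z, R.meet (R.comp x y) z =
      R.meet (R.comp (R.meet (R.comp z (R.conv y)) x) (R.meet y (R.comp (R.conv x) z))) z) ∧
    (∀ x, R.meet R.zero x = R.zero) ∧
    (∀ x, R.meet x R.one = x) ∧
    (∀ x, R.comp x R.zero = R.zero) := by
  let _ := R.toBooleanAlgebra
  refine ⟨R.meet_assoc, R.meet_comm, inf_idem, R.ra4, R.ra6, fun x y z => ?_, R.ra7, R.ra9,
    R.conv_meet, fun x y z => ?_, bot_inf_eq, inf_top_eq, R.comp_zero⟩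
  · exact (inf_eq_left.2 (R.comp_le_comp inf_le_right le_rfl)).symm
  · exact le_antisymm (le_inf (R.comp_inf_le x y z) inf_le_right)
      (inf_le_inf_right z (R.comp_le_comp inf_le_right inf_le_left))
end

section
/- Let A be a J-algebra and a, b ∈ A. If 1 = a˘;b and a˘;a ≤ 1', then a˘;a = 1'. -/
/-- A J-algebra: an algebra (A, ·, 0, 1, ;, ˘, 1') satisfying Jónsson's axioms. -/
structure JAlgebra (A : Type*) where
  meet : A → A → A        -- Boolean product ·
  comp : A → A → A        -- relative product ;
  conv : A → A            -- converse ˘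
  zero : A                -- 0
  one : A                 -- 1
  ident : A               -- 1'
  massoc : ∀ x y z, meet x (meet y z) = meet (meet x y) z
  mcomm : ∀ x y, meet x y = meet y x
  midem : ∀ x, meet x x = x
  cassoc : ∀ x y z, comp x (comp y z) = comp (comp x y) z
  cid : ∀ x, comp x ident = x
  semidist : ∀ x y z, comp (meet x y) z = meet (comp (meet x y) z) (comp y z)
  convconv : ∀ x, conv (conv x) = x
  convcomp : ∀ x y, conv (comp x y) = comp (conv y) (conv x)
  convmeet : ∀ x y, conv (meet x y) = meet (conv x) (conv y)
  rot : ∀ x y z, meet (comp x y) z =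
    meet (comp (meet (comp z (conv y)) x) (meet y (comp (conv x) z))) z
  zbot : ∀ x, meet zero x = zero
  otop : ∀ x, meet x one = x
  comp_zero : ∀ x, comp x zero = zero

/-- x ≤ y iff x·y = x. -/
def JAlgebra.le {A : Type*} (J : JAlgebra A) (x y : A) : Prop := J.meet x y = x

/-- x is functional iff x˘;x ≤ 1'. -/
def JAlgebra.Functional {A : Type*} (J : JAlgebra A) (x : A) : Prop :=
  J.le (J.comp (J.conv x) x) J.ident

/-- x is permutational iff x;x˘ = 1' = x˘;x. -/
def JAlgebra.Permutational {A : Type*} (J : JAlgebra A) (x : A) : Prop :=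
  J.comp x (J.conv x) = J.ident ∧ J.comp (J.conv x) x = J.ident

namespace JAlgebra

variable {A : Type*} (J : JAlgebra A) {x y z : A}

theorem le_antisymm (h : J.le x y) (h' : J.le y x) : x = y :=
  h.symm.trans ((J.mcomm x y).trans h')

theorem le_trans (h : J.le x y) (h' : J.le y z) : J.le x z := by
  unfold le at *
  rw [← h, ← J.massoc, h']

theorem meet_le_right (x y : A) : J.le (J.meet x y) y := by
  unfold le
  rw [← J.massoc, J.midem]

theorem conv_mono (h : J.le x y) : J.le (J.conv x) (J.conv y) := by
  unfold le at *
  rw [← J.convmeet, h]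

theorem comp_mono_left (h : J.le x y) (z : A) : J.le (J.comp x z) (J.comp y z) := by
  have := J.semidist x y z
  rw [h] at this
  exact this.symm

theorem comp_mono_right (h : J.le x y) (z : A) : J.le (J.comp z x) (J.comp z y) := by
  have := J.conv_mono (J.comp_mono_left (J.conv_mono h) (J.conv z))
  simpa only [J.convcomp, J.convconv] using this

end JAlgebra

/-- If 1 = a˘;b and a˘;a ≤ 1' in a J-algebra, then a˘;a = 1'. -/
theorem conv_comp_self_eq_ident {A : Type*} (J : JAlgebra A) (a b : A)
    (h1 : J.one = J.comp (J.conv a) b)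
    (h2 : J.le (J.comp (J.conv a) a) J.ident) :
    J.comp (J.conv a) a = J.ident := by
  refine J.le_antisymm h2 ?_
  have h := J.rot (J.conv a) b J.ident
  rw [← h1, J.mcomm J.one, J.otop, J.convconv, J.cid] at h
  have h_le : J.le J.ident _ := (J.mcomm _ _).trans h.symm
  exact J.le_trans h_le (J.le_trans (J.comp_mono_left (J.meet_le_right _ _) _)
    (J.comp_mono_right (J.meet_le_right _ _) _))
end

section
/- Let A be a J-algebra and x, y ∈ A. If 1 = x;1 = y;1 and (x;x˘)·(y;y˘) ≤ 1', then (x;x˘)·(y;y˘) = 1'. -/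
/-- If `x;1 = 1`, then `1' ≤ x;x˘`. -/
theorem JAlgebra.ident_le_comp_conv {A : Type*} (J : JAlgebra A) (x : A)
    (hx : J.one = J.comp x J.one) : J.le J.ident (J.comp x (J.conv x)) := by
  have one_meet : ∀ a, J.meet J.one a = a := fun a => by rw [J.mcomm, J.otop]
  have hrot := J.rot x J.one J.ident
  rw [← hx, J.cid, one_meet, one_meet, J.semidist] at hrot
  unfold JAlgebra.le
  generalize J.comp (J.meet (J.comp J.ident (J.conv J.one)) x) (J.conv x) = u at hrot
  calc J.meet J.ident (J.comp x (J.conv x))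
      = J.meet (J.meet (J.meet u (J.comp x (J.conv x))) J.ident) (J.comp x (J.conv x)) := by
        rw [← hrot]
    _ = J.meet (J.meet u (J.meet (J.comp x (J.conv x)) (J.comp x (J.conv x)))) J.ident := by
        rw [← J.massoc, J.mcomm J.ident, J.massoc, ← J.massoc u]
    _ = J.ident := by rw [J.midem, ← hrot]

/-- If 1 = x;1 = y;1 and (x;x˘)·(y;y˘) ≤ 1' in a J-algebra,
then (x;x˘)·(y;y˘) = 1'. -/
theorem meet_comp_conv_eq_ident {A : Type*} (J : JAlgebra A) (x y : A)
    (hx : J.one = J.comp x J.one) (hy : J.one = J.comp y J.one)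
    (h : J.le (J.meet (J.comp x (J.conv x)) (J.comp y (J.conv y))) J.ident) :
    J.meet (J.comp x (J.conv x)) (J.comp y (J.conv y)) = J.ident := by
  have hxi := J.ident_le_comp_conv x hx
  have hyi := J.ident_le_comp_conv y hy
  unfold JAlgebra.le at h hxi hyi
  rw [← h, J.mcomm, J.massoc, hxi, hyi]
end

section
/- Let A be a J-algebra and a, b, c, d, u, v, x, y ∈ A with u ≤ c˘;d and v;y˘ ≤ a˘;b. (i) If c and d are functional, then (u;v)·(x;y) ≤ ((u;a˘)·(x;b˘));((a;v)·(b;y)). (ii) If a, b, c, d are all functional, then (u;v)·(x;y) = ((u;a˘)·(x;b˘));((a;v)·(b;y)). -/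
namespace JAlgebra

variable {A : Type*} (J : JAlgebra A) {p q r s : A}

theorem le_trans_s5 (h : J.le p q) (k : J.le q r) : J.le p r := by
  unfold le at *
  rw [← h, ← J.massoc, k]

theorem le_antisymm_s5 (h : J.le p q) (k : J.le q p) : p = q :=
  h.symm.trans ((J.mcomm p q).trans k)

theorem meet_le_right_s5 (p q : A) : J.le (J.meet p q) q := by
  unfold le
  rw [← J.massoc, J.midem]

theorem meet_le_left (p q : A) : J.le (J.meet p q) p := by
  rw [J.mcomm]
  exact J.meet_le_right_s5 q p

theorem le_meet (h : J.le p q) (k : J.le p r) : J.le p (J.meet q r) := by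
  unfold le at *
  rw [J.massoc, h, k]

theorem meet_mono (h : J.le p q) (k : J.le r s) : J.le (J.meet p r) (J.meet q s) :=
  J.le_meet (J.le_trans_s5 (J.meet_le_left p r) h) (J.le_trans_s5 (J.meet_le_right_s5 p r) k)

theorem le_refl (p : A) : J.le p p := J.midem p

theorem conv_mono_s5 (h : J.le p q) : J.le (J.conv p) (J.conv q) := by
  unfold le at *
  rw [← J.convmeet, h]

theorem comp_mono_left_s5 (h : J.le p q) (r : A) : J.le (J.comp p r) (J.comp q r) := by
  unfold le at *
  have := J.semidist p q r
  rw [h] at this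
  exact this.symm

theorem comp_mono_right_s5 (h : J.le p q) (r : A) : J.le (J.comp r p) (J.comp r q) := by
  have := J.conv_mono_s5 (J.comp_mono_left_s5 (J.conv_mono_s5 h) (J.conv r))
  simpa only [J.convcomp, J.convconv] using this

theorem comp_mono (h : J.le p q) (k : J.le r s) : J.le (J.comp p r) (J.comp q s) :=
  J.le_trans_s5 (J.comp_mono_left_s5 h r) (J.comp_mono_right_s5 k q)

theorem conv_ident : J.conv J.ident = J.ident := by
  have := J.convcomp (J.conv J.ident) J.ident
  rwa [J.cid, J.convconv, J.cid, eq_comm] at this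

theorem ident_comp (p : A) : J.comp J.ident p = p := by
  have := J.convcomp (J.conv p) J.ident
  rwa [J.cid, J.convconv, J.conv_ident, eq_comm] at this

theorem meet_comp_le_left (p q r : A) :
    J.le (J.meet (J.comp p q) r) (J.comp (J.meet (J.comp r (J.conv q)) p) q) := by
  rw [J.rot]
  exact J.le_trans_s5 (J.meet_le_left _ _) (J.comp_mono_right_s5 (J.meet_le_left _ _) _)

theorem meet_comp_le_right (p q r : A) :
    J.le (J.meet (J.comp p q) r) (J.comp p (J.meet q (J.comp (J.conv p) r))) := by
  rw [J.rot]
  exact J.le_trans_s5 (J.meet_le_left _ _) (J.comp_mono_left_s5 (J.meet_le_right_s5 _ _) _)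

theorem comp_conv_comp_le (hp : J.Functional p) (q : A) :
    J.le (J.comp (J.comp q (J.conv p)) p) q := by
  have := J.comp_mono_right_s5 hp q
  rwa [J.cid, J.cassoc] at this

theorem conv_comp_comp_le (hp : J.Functional p) (q : A) :
    J.le (J.comp (J.conv p) (J.comp p q)) q := by
  have := J.comp_mono_left_s5 hp q
  rwa [J.ident_comp, ← J.cassoc] at this

variable {a b d v y : A}

/-- The pairing inequality when the first factor is functional. -/
theorem pairing_le_of_functional (hd : J.Functional d)
    (hv : J.le (J.comp v (J.conv y)) (J.comp (J.conv a) b)) (x : A) :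
    J.le (J.meet (J.comp d v) (J.comp x y))
      (J.comp (J.meet (J.comp d (J.conv a)) (J.comp x (J.conv b)))
        (J.meet (J.comp a v) (J.comp b y))) := by
  have h : J.le (J.meet (J.comp (J.comp d v) (J.conv y)) x)
      (J.comp (J.meet (J.comp d (J.conv a)) (J.comp x (J.conv b))) b) := by
    rw [← J.cassoc]
    refine J.le_trans_s5 (J.meet_mono (J.comp_mono_right_s5 hv d) (J.le_refl x)) ?_
    rw [J.cassoc, J.mcomm (J.comp d _)]
    exact J.meet_comp_le_left _ _ _
  set w := J.meet (J.comp d (J.conv a)) (J.comp x (J.conv b))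
  have hwd : J.le (J.comp (J.conv w) d) a := by
    refine J.le_trans_s5 (J.comp_mono_left_s5 (J.conv_mono_s5 (J.meet_le_left _ _)) d) ?_
    rw [J.convcomp, J.convconv]
    exact J.comp_conv_comp_le hd a
  have hxy : J.le (J.meet (J.comp d v) (J.comp x y)) (J.comp w (J.comp b y)) := by
    rw [J.mcomm, J.cassoc]
    exact J.le_trans_s5 (J.meet_comp_le_left _ _ _) (J.comp_mono_left_s5 h y)
  refine J.le_trans_s5 (J.le_meet hxy (J.meet_le_left _ _)) ?_
  refine J.le_trans_s5 (J.meet_comp_le_right _ _ _) (J.comp_mono_right_s5 ?_ w)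
  rw [J.mcomm, J.cassoc]
  exact J.meet_mono (J.comp_mono_left_s5 hwd v) (J.le_refl _)

variable {c u : A}

theorem pairing_le (hu : J.le u (J.comp (J.conv c) d))
    (hv : J.le (J.comp v (J.conv y)) (J.comp (J.conv a) b))
    (hc : J.Functional c) (hd : J.Functional d) (x : A) :
    J.le (J.meet (J.comp u v) (J.comp x y))
      (J.comp (J.meet (J.comp u (J.conv a)) (J.comp x (J.conv b)))
        (J.meet (J.comp a v) (J.comp b y))) := by
  have hue : J.le u (J.comp (J.meet (J.comp u (J.conv d)) (J.conv c)) d) :=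
    J.le_trans_s5 (J.le_meet hu (J.le_refl u)) (J.meet_comp_le_left _ _ _)
  set e := J.meet (J.comp u (J.conv d)) (J.conv c)
  have hed : J.le (J.comp e d) u :=
    J.le_trans_s5 (J.comp_mono_left_s5 (J.meet_le_left _ _) d) (J.comp_conv_comp_le hd u)
  have hec : J.le e (J.conv c) := J.meet_le_right_s5 _ _
  have hec' : J.le (J.conv e) c := by
    have := J.conv_mono_s5 hec
    rwa [J.convconv] at this
  have hee (z : A) : J.le (J.comp e (J.comp (J.conv e) z)) z :=
    J.le_trans_s5 (J.comp_mono hec (J.comp_mono_left_s5 hec' z)) (J.conv_comp_comp_le hc z)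
  refine J.le_trans_s5 (J.meet_mono (J.comp_mono_left_s5 hue v) (J.le_refl _)) ?_
  rw [← J.cassoc]
  refine J.le_trans_s5 (J.meet_comp_le_right _ _ _) ?_
  rw [J.cassoc (J.conv e)]
  refine J.le_trans_s5 (J.comp_mono_right_s5 (J.pairing_le_of_functional hd hv _) e) ?_
  rw [J.cassoc e]
  refine J.comp_mono_left_s5 (J.le_meet ?_ ?_) _
  · refine J.le_trans_s5 (J.comp_mono_right_s5 (J.meet_le_left _ _) e) ?_
    rw [J.cassoc]
    exact J.comp_mono_left_s5 hed _
  · refine J.le_trans_s5 (J.comp_mono_right_s5 (J.meet_le_right_s5 _ _) e) ?_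
    rw [← J.cassoc]
    exact hee _

theorem pairing_ge (ha : J.Functional a) (hb : J.Functional b) (u v x y : A) :
    J.le (J.comp (J.meet (J.comp u (J.conv a)) (J.comp x (J.conv b)))
        (J.meet (J.comp a v) (J.comp b y)))
      (J.meet (J.comp u v) (J.comp x y)) := by
  refine J.le_meet ?_ ?_
  · refine J.le_trans_s5 (J.comp_mono (J.meet_le_left _ _) (J.meet_le_left _ _)) ?_
    rw [J.cassoc]
    exact J.comp_mono_left_s5 (J.comp_conv_comp_le ha u) v
  · refine J.le_trans_s5 (J.comp_mono (J.meet_le_right_s5 _ _) (J.meet_le_right_s5 _ _)) ?_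
    rw [J.cassoc]
    exact J.comp_mono_left_s5 (J.comp_conv_comp_le hb x) y

end JAlgebra

/-- Prop. (pair): assume u ≤ c˘;d and v;y˘ ≤ a˘;b.
(i) If c, d are functional then (u;v)·(x;y) ≤ ((u;a˘)·(x;b˘));((a;v)·(b;y)).
(ii) If a, b, c, d are all functional then equality holds. -/
theorem pairing_from_bounds {A : Type*} (J : JAlgebra A) (a b c d u v x y : A)
    (hu : J.le u (J.comp (J.conv c) d))
    (hv : J.le (J.comp v (J.conv y)) (J.comp (J.conv a) b)) :
    (J.Functional c → J.Functional d →
      J.le (J.meet (J.comp u v) (J.comp x y))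
        (J.comp (J.meet (J.comp u (J.conv a)) (J.comp x (J.conv b)))
                (J.meet (J.comp a v) (J.comp b y)))) ∧
    (J.Functional a → J.Functional b → J.Functional c → J.Functional d →
      J.meet (J.comp u v) (J.comp x y) =
        J.comp (J.meet (J.comp u (J.conv a)) (J.comp x (J.conv b)))
               (J.meet (J.comp a v) (J.comp b y))) :=
  ⟨fun hc hd => J.pairing_le hu hv hc hd x,
    fun ha hb hc hd => J.le_antisymm_s5 (J.pairing_le hu hv hc hd x) (J.pairing_ge ha hb u v x y)⟩
end

section
/- Let A be a J-algebra and a, b ∈ A such that the pairing identity holds for a, b: for all u, v, x, y, (u;v)·(x;y) = ((u;a˘)·(x;b˘));((a;v)·(b;y)). Define x⊗y = (a;x;a˘)·(b;y;b˘). Then for all u, v, x, y ∈ A: (u⊗v);(x⊗y) = (u;x)⊗(v;y); moreover (x⊗1');(1'⊗y) = x⊗y = (1'⊗y);(x⊗1'). -/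
/-- Parallel composition x⊗y = (a;x;a˘)·(b;y;b˘) with parameters a, b. -/
def JAlgebra.otimes {A : Type*} (J : JAlgebra A) (a b x y : A) : A :=
  J.meet (J.comp (J.comp a x) (J.conv a)) (J.comp (J.comp b y) (J.conv b))

/-- The identity is also a left unit. -/
theorem JAlgebra.ident_comp_s9 {A : Type*} (J : JAlgebra A) (x : A) : J.comp J.ident x = x := by
  have left_unit : ∀ z, J.comp (J.conv J.ident) z = z := fun z => by
    rw [← J.convconv z, ← J.convcomp, J.cid]
  have conv_ident : J.conv J.ident = J.ident := by
    rw [← J.cid (J.conv J.ident), left_unit]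
  rw [← conv_ident, left_unit]

/-- If the pairing identity holds for a, b, then ⊗ satisfies
(u⊗v);(x⊗y) = (u;x)⊗(v;y), and (x⊗1');(1'⊗y) = x⊗y = (1'⊗y);(x⊗1'). -/
theorem otimes_parallel_comp {A : Type*} (J : JAlgebra A) (a b : A)
    (hPr : ∀ u v x y : A,
      J.meet (J.comp u v) (J.comp x y) =
        J.comp (J.meet (J.comp u (J.conv a)) (J.comp x (J.conv b)))
               (J.meet (J.comp a v) (J.comp b y))) :
    (∀ u v x y : A,
      J.comp (J.otimes a b u v) (J.otimes a b x y) =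
        J.otimes a b (J.comp u x) (J.comp v y)) ∧
    (∀ x y : A,
      J.comp (J.otimes a b x J.ident) (J.otimes a b J.ident y) = J.otimes a b x y ∧
      J.otimes a b x y = J.comp (J.otimes a b J.ident y) (J.otimes a b x J.ident)) := by
  have parallel : ∀ u v x y : A,
      J.comp (J.otimes a b u v) (J.otimes a b x y) =
        J.otimes a b (J.comp u x) (J.comp v y) := fun u v x y => by
    have h := hPr (J.comp a u) (J.comp x (J.conv a)) (J.comp b v) (J.comp y (J.conv b))
    simp only [JAlgebra.otimes, J.cassoc] at h ⊢
    exact h.symm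
  refine ⟨parallel, fun x y => ⟨?_, ?_⟩⟩
  · rw [parallel, J.cid, J.ident_comp_s9]
  · rw [parallel, J.cid, J.ident_comp_s9]
end
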